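/- arXiv:2205.14936 — 2 statements merged into one kernel-verified Lean document; each statement's English description precedes it below -/
import Mathlib

section
/- Let x1, x2, x3, x4 be rational numbers with 0 ≤ xi ≤ 1/2 for all i, satisfying sin(x1·π)·sin(x2·π) = sin(x3·π)·sin(x4·π). Then at least one of the following four cases holds: (1) x1·x2 = 0 and x3·x4 = 0; (2) the unordered pair {x1,x2} equals the unordered pair {x3,x4}; (3) there exists a real θ with 0 < θ ≤ 1/2 such that either ({x1,x2} = {1/6, θ} and {x3,x4} = {θ/2, 1/2 − θ/2}) or ({x3,x4} = {1/6, θ} and {x1,x2} = {θ/2, 1/2 − θ/2}); (4) there is a quadruple (y1,y2,y3,y4) from the following list of fifteen such that either ({x1,x2} = {y1,y2} and {x3,x4} = {y3,y4}) or ({x1,x2} = {y3,y4} and {x3,x4} = {y1,y2}): (1/21, 8/21, 1/14, 3/14), (1/14, 5/14, 2/21, 5/21), (4/21, 10/21, 3/14, 5/14), (1/20, 9/20, 1/15, 4/15), (2/15, 7/15, 3/20, 7/20), (1/30, 3/10, 1/15, 2/15), (1/15, 7/15, 1/10, 7/30), (1/10, 13/30, 2/15, 4/15), (4/15, 7/15,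 3/10, 11/30), (1/30, 11/30, 1/10, 1/10), (7/30, 13/30, 3/10, 3/10), (1/15, 4/15, 1/10, 1/6), (2/15, 7/15, 1/6, 3/10), (1/12, 5/12, 1/10, 3/10), (1/10, 3/10, 1/6, 1/6). -/
open Real

/-- Unordered pair equality: `{a,b} = {c,d}`. -/
def pairEq (a b c d : ℚ) : Prop := (a = c ∧ b = d) ∨ (a = d ∧ b = c)

/-- The fifteen sporadic quadruples of Table 3.1. -/
def sporadicList : List (ℚ × ℚ × ℚ × ℚ) :=
  [(1/21, 8/21, 1/14, 3/14), (1/14, 5/14, 2/21, 5/21), (4/21, 10/21, 3/14, 5/14),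
   (1/20, 9/20, 1/15, 4/15), (2/15, 7/15, 3/20, 7/20), (1/30, 3/10, 1/15, 2/15),
   (1/15, 7/15, 1/10, 7/30), (1/10, 13/30, 2/15, 4/15), (4/15, 7/15, 3/10, 11/30),
   (1/30, 11/30, 1/10, 1/10), (7/30, 13/30, 3/10, 3/10), (1/15, 4/15, 1/10, 1/6),
   (2/15, 7/15, 1/6, 3/10), (1/12, 5/12, 1/10, 3/10), (1/10, 3/10, 1/6, 1/6)]


theorem cyc_dvd {N : ℕ} (hN : 0 < N) {ζ : ℂ} (hζ : IsPrimitiveRoot ζ N) (F : Polynomial ℤ)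
    (hF : Polynomial.aeval ζ F = 0) : Polynomial.cyclotomic N ℤ ∣ F := by
  rw [Polynomial.cyclotomic_eq_minpoly hζ hN]
  exact minpoly.isIntegrallyClosed_dvd (hζ.isIntegral hN) hF

theorem galois_sum {ι : Type*} [Fintype ι] {N : ℕ} (hN : 0 < N) {ζ : ℂ} (hζ : IsPrimitiveRoot ζ N)
    (e : ι → ℕ) (h : ∑ i, ζ ^ e i = 0) {r : ℕ} (hr : Nat.Coprime r N) :
    ∑ i, ζ ^ (e i * r) = 0 := by
  have h1 := cyc_dvd hN hζ (∑ i, Polynomial.X ^ e i) (by simpa using h)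
  obtain ⟨Q, hQ⟩ := h1
  have h2 : Polynomial.aeval (ζ ^ r) (Polynomial.cyclotomic N ℤ) = 0 := by
    rw [Polynomial.cyclotomic_eq_minpoly (hζ.pow_of_coprime r hr) hN]
    exact minpoly.aeval _ _
  have h3 := congrArg (Polynomial.aeval (ζ ^ r)) hQ
  rw [map_mul, h2, zero_mul] at h3
  simpa [← pow_mul, mul_comm] using h3

/-- The sum of the terms in the residue class `k` modulo `d`. -/
noncomputable def classSum {ι : Type*} [Fintype ι] (d : ℕ) (ζ : ℂ) (e : ι → ℕ) (k : ZMod d) : ℂ :=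
  ∑ i, if (e i : ZMod d) = k then ζ ^ e i else 0

theorem ortho {ι : Type*} [Fintype ι] {d M : ℕ} (hd : 0 < d) (hM : 0 < M) {ζ : ℂ}
    (hζ : IsPrimitiveRoot ζ (d * M)) (e : ι → ℕ) (k : ℕ) :
    ∑ t ∈ Finset.range d, ζ ^ (M * (t * ((d - 1) * k))) * ∑ i, ζ ^ (e i * (1 + t * M))
      = d * classSum d ζ e k := by
  have hω : IsPrimitiveRoot (ζ ^ M) d := hζ.pow (Nat.mul_pos hd hM) (mul_comm d M)
  unfold classSum
  simp_rw [Finset.mul_sum]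
  rw [Finset.sum_comm]
  refine Finset.sum_congr rfl fun i _ => ?_
  have e1 : ∀ t ∈ Finset.range d, ζ ^ (M * (t * ((d - 1) * k))) * ζ ^ (e i * (1 + t * M))
      = ζ ^ e i * ((ζ ^ M) ^ ((d - 1) * k + e i)) ^ t := by
    intro t _
    rw [← pow_mul, ← pow_mul, ← pow_add, ← pow_add]
    congr 1; ring
  rw [Finset.sum_congr rfl e1, ← Finset.mul_sum]
  have key : (ζ ^ M) ^ ((d - 1) * k + e i) = 1 ↔ (e i : ZMod d) = k := by
    rw [hω.pow_eq_one_iff_dvd, ← ZMod.natCast_eq_zero_iff]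
    obtain ⟨d', rfl⟩ : ∃ d', d = d' + 1 := ⟨d - 1, by omega⟩
    have : ((d' : ℕ) : ZMod (d' + 1)) = -1 := by
      have := ZMod.natCast_self (d' + 1)
      push_cast at this
      linear_combination this
    push_cast
    simp only [this]
    constructor
    · intro h; linear_combination h
    · intro h; linear_combination h
  by_cases hc : (e i : ZMod d) = k
  · rw [if_pos hc, key.mpr hc]; simp; ring
  · rw [if_neg hc, mul_zero]
    have hne : (ζ ^ M) ^ ((d - 1) * k + e i) ≠ 1 := fun h => hc (key.mp h)
    have : ((ζ ^ M) ^ ((d - 1) * k + e i)) ^ d = 1 := by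
      rw [← pow_mul, mul_comm, pow_mul, hω.pow_eq_one, one_pow]
    rw [geom_sum_eq hne, this]; simp

theorem classSum_zero {ι : Type*} [Fintype ι] {d M : ℕ} (hd : 0 < d) (hM : 0 < M) {ζ : ℂ}
    (hζ : IsPrimitiveRoot ζ (d * M)) (e : ι → ℕ) (h : ∑ i, ζ ^ e i = 0)
    (hrad : ∀ p, p.Prime → p ∣ d → p ∣ M) (k : ZMod d) : classSum d ζ e k = 0 := by
  have : NeZero d := ⟨hd.ne'⟩
  have h1 := ortho hd hM hζ e k.val
  rw [ZMod.natCast_zmod_val] at h1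
  rw [Finset.sum_eq_zero] at h1
  · have : (d : ℂ) ≠ 0 := by exact_mod_cast hd.ne'
    exact (mul_eq_zero.mp h1.symm).resolve_left this
  · intro t _
    rw [galois_sum (Nat.mul_pos hd hM) hζ e h, mul_zero]
    apply Nat.Coprime.symm
    apply Nat.coprime_of_dvd
    intro p hp hpN hp1
    have hpM : p ∣ M := by
      rcases (Nat.Prime.dvd_mul hp).mp hpN with h' | h'
      · exact hrad p hp h'
      · exact h'
    have : p ∣ 1 := (Nat.dvd_add_left (hpM.mul_left t)).mp hp1
    exact hp.one_lt.ne' (Nat.dvd_one.mp this)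

theorem classSum_const {ι : Type*} [Fintype ι] {p M : ℕ} (hp : p.Prime) (hM : 0 < M) {ζ : ℂ}
    (hζ : IsPrimitiveRoot ζ (p * M)) (e : ι → ℕ) (h : ∑ i, ζ ^ e i = 0)
    (hpM : ¬ p ∣ M) : ∃ η : ℂ, η ^ p = 1 ∧ ∀ k : ℕ,
      classSum p ζ e k = η ^ k * classSum p ζ e 0 := by
  have hd := hp.pos
  have : Fact p.Prime := ⟨hp⟩
  have hM0 : (M : ZMod p) ≠ 0 := by rwa [Ne, ZMod.natCast_eq_zero_iff]
  set t0 : ℕ := ((-(M : ZMod p)⁻¹).val) with ht0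
  have ht0lt : t0 < p := ZMod.val_lt _
  have key : ∀ t, t < p → t ≠ t0 → Nat.Coprime (1 + t * M) (p * M) := by
    intro t ht hne
    apply Nat.Coprime.mul_right
    · apply Nat.Coprime.symm
      rw [Nat.Prime.coprime_iff_not_dvd hp, ← ZMod.natCast_eq_zero_iff]
      intro h0
      push_cast at h0
      apply hne
      have h1 : (t : ZMod p) = -(M : ZMod p)⁻¹ := by
        field_simp
        linear_combination h0
      rw [ht0, ← h1, ZMod.val_cast_of_lt ht]
    · simp
  have main : ∀ k : ℕ, ζ ^ (M * (t0 * ((p - 1) * k))) * ∑ i, ζ ^ (e i * (1 + t0 * M))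
      = p * classSum p ζ e k := by
    intro k
    rw [← ortho hd hM hζ e k]
    symm
    apply Finset.sum_eq_single_of_mem t0 (Finset.mem_range.mpr ht0lt)
    intro t ht hne
    rw [galois_sum (Nat.mul_pos hd hM) hζ e h (key t (Finset.mem_range.mp ht) hne), mul_zero]
  refine ⟨ζ ^ (M * (t0 * (p - 1))), ?_, ?_⟩
  · rw [← pow_mul, show M * (t0 * (p - 1)) * p = (p * M) * (t0 * (p - 1)) by ring, pow_mul,
      hζ.pow_eq_one, one_pow]
  · intro k
    have hp0 : (p : ℂ) ≠ 0 := by exact_mod_cast hd.ne'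
    have h0 := main 0
    have hk := main k
    simp only [mul_zero, pow_zero, one_mul, Nat.cast_zero] at h0
    apply mul_left_cancel₀ hp0
    rw [← hk, h0, ← pow_mul]
    rw [show M * (t0 * (p - 1)) * k = M * (t0 * ((p - 1) * k)) by ring]
    ring

/-- `a` and `b` differ by a third of a full turn, up to signs. -/
def Near (a b : ℝ) : Prop := cos (a - b) = -1/2 ∨ cos (a + b) = -1/2

/-- The degenerate conclusions for a vanishing sum of four cosines. -/
def Degen (a b c d : ℝ) : Prop :=
  (cos a + cos b = 0 ∧ cos c + cos d = 0) ∨ (cos a + cos c = 0 ∧ cos b + cos d = 0) ∨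
  (cos a + cos d = 0 ∧ cos b + cos c = 0) ∨
  (cos d = 0 ∧ Near a b ∧ Near a c ∧ Near b c) ∨ (cos c = 0 ∧ Near a b ∧ Near a d ∧ Near b d) ∨
  (cos b = 0 ∧ Near a c ∧ Near a d ∧ Near c d) ∨ (cos a = 0 ∧ Near b c ∧ Near b d ∧ Near c d)

/-- The unit complex number at angle `a`. -/
noncomputable def cis (a : ℝ) : ℂ := ⟨cos a, sin a⟩

theorem cis_eq (a : ℝ) : cis a = Complex.exp (a * Complex.I) := by
  apply Complex.ext
  · rw [Complex.exp_ofReal_mul_I_re]; rfl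
  · rw [Complex.exp_ofReal_mul_I_im]; rfl

theorem near_of_sum {a b c : ℝ} (h : cis a + cis b + cis c = 0) : Near a b := by
  have h1 := congrArg Complex.re h
  have h2 := congrArg Complex.im h
  simp [cis] at h1 h2
  left
  rw [cos_sub]
  have e1 := sin_sq_add_cos_sq a
  have e2 := sin_sq_add_cos_sq b
  have e3 := sin_sq_add_cos_sq c
  have : cos c = - (cos a + cos b) := by linarith
  have : sin c = - (sin a + sin b) := by linarith
  simp only [*] at e3
  nlinarith

theorem re_two {a b : ℝ} (h : cis a + cis b = 0) : cos a + cos b = 0 := by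
  have h1 := congrArg Complex.re h
  simpa [cis] using h1

theorem four_units {a b c d : ℝ} (h : cis a + cis b + cis c + cis d = 0) :
    (cis a + cis b = 0 ∧ cis c + cis d = 0) ∨ (cis a + cis c = 0 ∧ cis b + cis d = 0) ∨
    (cis a + cis d = 0 ∧ cis b + cis c = 0) := by
  have inv : ∀ x, cis x * cis (-x) = 1 := by
    intro x
    rw [cis_eq, cis_eq, ← Complex.exp_add]; simp
  have hc : cis (-a) + cis (-b) + cis (-c) + cis (-d) = 0 := by
    have h1 := congrArg Complex.re h
    have h2 := congrArg Complex.im h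
    simp [cis] at h1 h2
    apply Complex.ext
    · simp [cis]; linarith
    · simp [cis]; linarith
  have ha := inv a
  have hb := inv b
  have hcc := inv c
  have hd := inv d
  have e3 : cis b * cis c * cis d + cis a * cis c * cis d + cis a * cis b * cis d
      + cis a * cis b * cis c = 0 := by
    linear_combination (cis a * cis b * cis c * cis d) * hc - (cis b * cis c * cis d) * ha
      - (cis a * cis c * cis d) * hb - (cis a * cis b * cis d) * hcc - (cis a * cis b * cis c) * hd
  have : (cis a + cis b) * ((cis a + cis c) * (cis a + cis d)) = 0 := by
    linear_combination (cis a) ^ 2 * h + e3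
  rcases mul_eq_zero.mp this with h' | h'
  · left; exact ⟨h', by linear_combination h - h'⟩
  rcases mul_eq_zero.mp h' with h' | h'
  · right; left; exact ⟨h', by linear_combination h - h'⟩
  · right; right; exact ⟨h', by linear_combination h - h'⟩

/-- If some nonempty partial sum of units vanishes, we are in a degenerate case. -/
theorem degen_of_split (a b c d : ℝ) (z₁ z₂ z₃ z₄ : ℂ)
    (hs : cos a + cos b + cos c + cos d = 0)
    (h1 : z₁ = 0 ∨ z₁ = cis a) (h2 : z₂ = 0 ∨ z₂ = cis b) (h3 : z₃ = 0 ∨ z₃ = cis c)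
    (h4 : z₄ = 0 ∨ z₄ = cis d) (hz : z₁ + z₂ + z₃ + z₄ = 0)
    (hne : z₁ ≠ 0 ∨ z₂ ≠ 0 ∨ z₃ ≠ 0 ∨ z₄ ≠ 0) : Degen a b c d := by
  have cne : ∀ x, cis x ≠ 0 := by
    intro x; rw [cis_eq]; exact Complex.exp_ne_zero _
  have near : ∀ {x y z : ℝ}, cis x + cis y + cis z = 0 → Near x y ∧ Near x z ∧ Near y z := by
    intro x y z h
    exact ⟨near_of_sum h, near_of_sum (c := y) (by linear_combination h),
      near_of_sum (c := x) (by linear_combination h)⟩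
  have re3 : ∀ {x y z : ℝ}, cis x + cis y + cis z = 0 → cos x + cos y + cos z = 0 := by
    intro x y z h
    have h1 := congrArg Complex.re h
    simpa [cis] using h1
  have two : ∀ {x y : ℝ}, cis x + cis y = 0 → cos x + cos y = 0 := re_two
  unfold Degen
  rcases h1 with rfl | rfl <;> rcases h2 with rfl | rfl <;> rcases h3 with rfl | rfl <;>
    rcases h4 with rfl | rfl <;> try simp only [zero_add, add_zero] at hz
  · simp at hne
  · exact absurd hz (cne _)
  · exact absurd hz (cne _)
  · left; have := two hz; constructor <;> linarith
  · exact absurd hz (cne _)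
  · right; left; have := two hz; constructor <;> linarith
  · right; right; left; have := two hz; constructor <;> linarith
  · iterate 6 right
    exact ⟨by have := re3 hz; linarith, near hz⟩
  · exact absurd hz (cne _)
  · right; right; left; have := two hz; constructor <;> linarith
  · right; left; have := two hz; constructor <;> linarith
  · iterate 5 right
    left
    exact ⟨by have := re3 hz; linarith, near hz⟩
  · left; have := two hz; constructor <;> linarith
  · iterate 4 right
    left
    exact ⟨by have := re3 hz; linarith, near hz⟩
  · iterate 3 right
    left
    exact ⟨by have := re3 hz; linarith, near hz⟩
  · rcases four_units hz with h | h | h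
    · left; exact ⟨two h.1, two h.2⟩
    · right; left; exact ⟨two h.1, two h.2⟩
    · right; right; left; exact ⟨two h.1, two h.2⟩

theorem near_neg_left {a b : ℝ} : Near (-a) b ↔ Near a b := by
  unfold Near
  rw [show -a - b = -(a + b) by ring, show -a + b = -(a - b) by ring, cos_neg, cos_neg, or_comm]

theorem near_neg_right {a b : ℝ} : Near a (-b) ↔ Near a b := by
  unfold Near
  rw [show a - -b = a + b by ring, show a + -b = a - b by ring, or_comm]

theorem degen_of_signs {a b c d a' b' c' d' : ℝ} (ha : a' = a ∨ a' = -a) (hb : b' = b ∨ b' = -b)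
    (hc : c' = c ∨ c' = -c) (hd : d' = d ∨ d' = -d) (h : Degen a' b' c' d') : Degen a b c d := by
  rcases ha with rfl | rfl <;> rcases hb with rfl | rfl <;> rcases hc with rfl | rfl <;>
    rcases hd with rfl | rfl <;>
    simpa only [Degen, near_neg_left, near_neg_right, cos_neg] using h

/-- The angle `2π n / N`. -/
noncomputable def ang (N n : ℕ) : ℝ := 2 * π * n / N

/-- The exponents of the eight roots of unity. -/
def expo (N : ℕ) (n : Fin 4 → ℕ) : Fin 4 ⊕ Fin 4 → ℕ
  | .inl i => n i
  | .inr i => (N - 1) * n i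

/-- The standard primitive root. -/
noncomputable def zeta (N : ℕ) : ℂ := Complex.exp (2 * π * Complex.I / N)

theorem zeta_pow (N n : ℕ) : zeta N ^ n = cis (ang N n) := by
  rw [zeta, cis_eq, ← Complex.exp_nat_mul]
  congr 1
  simp only [ang]
  push_cast
  ring

theorem cis_mul_neg (x : ℝ) : cis x * cis (-x) = 1 := by
  rw [cis_eq, cis_eq, ← Complex.exp_add]; simp

theorem cis_ne (x : ℝ) : cis x ≠ 0 := by
  rw [cis_eq]; exact Complex.exp_ne_zero _

theorem cis_add_neg (x : ℝ) : cis x + cis (-x) = ((2 * cos x : ℝ) : ℂ) := by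
  apply Complex.ext
  · change cos x + cos (-x) = 2 * cos x
    rw [cos_neg]; ring
  · change sin x + sin (-x) = 0
    rw [sin_neg]; ring

theorem zeta_prim {N : ℕ} (hN : 0 < N) : IsPrimitiveRoot (zeta N) N :=
  Complex.isPrimitiveRoot_exp N hN.ne'

theorem zeta_pow_neg {N : ℕ} (hN : 0 < N) (n : ℕ) : zeta N ^ ((N - 1) * n) = cis (-ang N n) := by
  apply mul_left_cancel₀ (cis_ne (ang N n))
  rw [cis_mul_neg, ← zeta_pow, ← pow_add]
  rw [show n + (N - 1) * n = N * n by
    obtain ⟨m, rfl⟩ : ∃ m, N = m + 1 := ⟨N - 1, by omega⟩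
    simp; ring, pow_mul, (zeta_prim hN).pow_eq_one, one_pow]

/-- Contribution of one cosine to a class sum. -/
noncomputable def term (N d n : ℕ) (k : ZMod d) : ℂ :=
  (if (n : ZMod d) = k then cis (ang N n) else 0)
    + (if -(n : ZMod d) = k then cis (-ang N n) else 0)

theorem classSum_expo {N d : ℕ} (hN : 0 < N) (hd : d ∣ N) (n : Fin 4 → ℕ) (k : ZMod d) :
    classSum d (zeta N) (expo N n) k
      = term N d (n 0) k + term N d (n 1) k + term N d (n 2) k + term N d (n 3) k := by
  have hc : ∀ m : ℕ, (((N - 1) * m : ℕ) : ZMod d) = -(m : ZMod d) := by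
    intro m
    have : ((N : ℕ) : ZMod d) = 0 := (ZMod.natCast_eq_zero_iff _ _).mpr hd
    rw [Nat.cast_mul, Nat.cast_sub (by omega), this]
    simp
  unfold classSum
  rw [Fintype.sum_sum_type]
  simp only [expo, Fin.sum_univ_four, term, hc, zeta_pow_neg hN, zeta_pow]
  ring

theorem sum_expo {N : ℕ} (hN : 0 < N) (n : Fin 4 → ℕ)
    (h : cos (ang N (n 0)) + cos (ang N (n 1)) + cos (ang N (n 2)) + cos (ang N (n 3)) = 0) :
    ∑ i, zeta N ^ expo N n i = 0 := by
  rw [Fintype.sum_sum_type]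
  simp only [expo, Fin.sum_univ_four, zeta_pow_neg hN, zeta_pow]
  have e0 := cis_add_neg (ang N (n 0))
  have e1 := cis_add_neg (ang N (n 1))
  have e2 := cis_add_neg (ang N (n 2))
  have e3 := cis_add_neg (ang N (n 3))
  have hh : ((2 * cos (ang N (n 0)) : ℝ) : ℂ) + ((2 * cos (ang N (n 1)) : ℝ) : ℂ)
      + ((2 * cos (ang N (n 2)) : ℝ) : ℂ) + ((2 * cos (ang N (n 3)) : ℝ) : ℂ) = 0 := by
    rw [← Complex.ofReal_add, ← Complex.ofReal_add, ← Complex.ofReal_add]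
    norm_cast
    linarith
  linear_combination e0 + e1 + e2 + e3 + hh

theorem term_cases {N d : ℕ} (n : ℕ) {k : ZMod d} (hk : k ≠ -k) :
    ∃ a', (a' = ang N n ∨ a' = -ang N n) ∧ (term N d n k = 0 ∨ term N d n k = cis a') ∧
      ((n : ZMod d) = k → term N d n k ≠ 0) := by
  unfold term
  by_cases h1 : (n : ZMod d) = k
  · have h2 : ¬ -(n : ZMod d) = k := by rw [h1]; exact fun h => hk h.symm
    refine ⟨ang N n, Or.inl rfl, Or.inr ?_, fun _ => ?_⟩
    · rw [if_pos h1, if_neg h2, add_zero]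
    · rw [if_pos h1, if_neg h2, add_zero]; exact cis_ne _
  · by_cases h2 : -(n : ZMod d) = k
    · refine ⟨-ang N n, Or.inr rfl, Or.inr ?_, fun h => absurd h h1⟩
      rw [if_pos h2, if_neg h1, zero_add]
    · refine ⟨ang N n, Or.inl rfl, Or.inl ?_, fun h => absurd h h1⟩
      rw [if_neg h2, if_neg h1, zero_add]

theorem split_step {N d : ℕ} (hN : 0 < N) (hd : d ∣ N) (n : Fin 4 → ℕ)
    (hs : cos (ang N (n 0)) + cos (ang N (n 1)) + cos (ang N (n 2)) + cos (ang N (n 3)) = 0)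
    (i : Fin 4) (hk : (n i : ZMod d) ≠ -(n i : ZMod d))
    (h0 : classSum d (zeta N) (expo N n) (n i : ZMod d) = 0) :
    Degen (ang N (n 0)) (ang N (n 1)) (ang N (n 2)) (ang N (n 3)) := by
  rw [classSum_expo hN hd] at h0
  obtain ⟨a, ha, ha', ha''⟩ := term_cases (N := N) (n 0) hk
  obtain ⟨b, hb, hb', hb''⟩ := term_cases (N := N) (n 1) hk
  obtain ⟨c, hc, hc', hc''⟩ := term_cases (N := N) (n 2) hk
  obtain ⟨e, he, he', he''⟩ := term_cases (N := N) (n 3) hk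
  have ec : ∀ {x y : ℝ}, (x = y ∨ x = -y) → cos x = cos y := by
    rintro x y (rfl | rfl)
    · rfl
    · exact cos_neg _
  refine degen_of_signs ha hb hc he (degen_of_split a b c e _ _ _ _ ?_ ha' hb' hc' he' h0 ?_)
  · rw [ec ha, ec hb, ec hc, ec he]; exact hs
  · fin_cases i
    · exact Or.inl (ha'' rfl)
    · exact Or.inr (Or.inl (hb'' rfl))
    · exact Or.inr (Or.inr (Or.inl (hc'' rfl)))
    · exact Or.inr (Or.inr (Or.inr (he'' rfl)))

theorem ne_neg_of_odd_prime {p : ℕ} (hp : p.Prime) (h2 : p ≠ 2) {m : ℕ} (hm : ¬ p ∣ m) :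
    (m : ZMod p) ≠ -(m : ZMod p) := by
  intro h
  have h3 : ((2 * m : ℕ) : ZMod p) = 0 := by push_cast; linear_combination h
  rw [ZMod.natCast_eq_zero_iff, Nat.Prime.dvd_mul hp] at h3
  rcases h3 with h3 | h3
  · exact h2 ((Nat.prime_dvd_prime_iff_eq hp Nat.prime_two).mp h3)
  · exact hm h3

set_option synthInstance.maxHeartbeats 400000 in
set_option synthInstance.maxSize 2000 in
theorem seven_pigeon : ∀ a b c d : ZMod 7,
    (∀ k : ZMod 7, (a = k ∨ -a = k) ∨ (b = k ∨ -b = k) ∨ (c = k ∨ -c = k) ∨ (d = k ∨ -d = k)) →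
    (a ≠ 0 → (-a ≠ a ∧ b ≠ a ∧ -b ≠ a ∧ c ≠ a ∧ -c ≠ a ∧ d ≠ a ∧ -d ≠ a)) ∧
    (a = 0 → (b ≠ 0 ∧ c ≠ 0 ∧ d ≠ 0)) := by
  decide +kernel

theorem cis_pow_six {x : ℝ} (h : (2 * cos x) ^ 2 = 1) : cis x ^ 6 = 1 := by
  have h1 := cis_mul_neg x
  have h2 := cis_add_neg x
  have h3 : (cis x + cis (-x)) ^ 2 = 1 := by rw [h2]; exact_mod_cast h
  have h4 : cis x ^ 4 + cis x ^ 2 + 1 = 0 := by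
    linear_combination (cis x)^2 * h3 - 2 * (cis x)^2 * h1 -
      (cis x * cis (-x) + 1) * h1
  linear_combination (cis x ^ 2 - 1) * h4

theorem dvd_of_cis {N n m : ℕ} (hN : 0 < N) (h : cis (ang N n) ^ m = 1) : N ∣ m * n := by
  rw [← zeta_pow, ← pow_mul, (zeta_prim hN).pow_eq_one_iff_dvd] at h
  rwa [mul_comm]

/-- One component of the conclusion in the case of the prime seven. -/
theorem seven_case {N : ℕ} (a b c d : ℕ) {η : ℂ} (hη : η ^ 7 = 1) (S : ZMod 7 → ℂ)
    (hS : ∀ k : ZMod 7, S k = term N 7 a k + term N 7 b k + term N 7 c k + term N 7 d k)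
    (hc : ∀ k : ℕ, S k = η ^ k * S 0)
    (hall : ∀ k : ZMod 7, ((a : ZMod 7) = k ∨ -(a : ZMod 7) = k) ∨ ((b : ZMod 7) = k ∨ -(b : ZMod 7) = k)
      ∨ ((c : ZMod 7) = k ∨ -(c : ZMod 7) = k) ∨ ((d : ZMod 7) = k ∨ -(d : ZMod 7) = k)) :
    (S 0).im = 0 ∧ ((a : ZMod 7) ≠ 0 → S 0 ^ 2 = 1 ∧ cis (ang N a) ^ 42 = 1) ∧
    ((a : ZMod 7) = 0 → S 0 ^ 2 = 1 → cis (ang N a) ^ 42 = 1) ∧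
    ((a : ZMod 7) = 0 → (b : ZMod 7) ≠ 0) := by
  have him : (S 0).im = 0 := by
    rw [hS]
    have : ∀ m, (term N 7 m 0).im = 0 := by
      intro m
      unfold term
      by_cases h : (m : ZMod 7) = 0
      · simp [h, cis]
      · simp [h]
    simp [this]
  obtain ⟨p1, p2⟩ := seven_pigeon _ _ _ _ hall
  refine ⟨him, ?_, ?_, fun h => (p2 h).1⟩
  · intro ha
    obtain ⟨q1, q2, q3, q4, q5, q6, q7⟩ := p1 ha
    have h1 : S a = cis (ang N a) := by
      rw [hS]; simp [term, q1, q2, q3, q4, q5, q6, q7]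
    have h2 := hc a
    rw [h1] at h2
    have hηn : ‖η‖ = 1 := Complex.norm_eq_one_of_pow_eq_one hη (by norm_num)
    have h3 : ‖S 0‖ = 1 := by
      have := congrArg norm h2
      rw [norm_mul, norm_pow, hηn, one_pow, one_mul, cis_eq, Complex.norm_exp_ofReal_mul_I] at this
      exact this.symm
    have h4 : S 0 ^ 2 = 1 := by
      have h5 : S 0 = ((S 0).re : ℂ) := by
        apply Complex.ext <;> simp [him]
      rw [h5] at h3 ⊢
      rw [Complex.norm_real, Real.norm_eq_abs] at h3
      have : (S 0).re ^ 2 = 1 := by rw [← sq_abs, h3]; norm_num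
      exact_mod_cast this
    refine ⟨h4, ?_⟩
    rw [h2, mul_pow, ← pow_mul, show a * 42 = 7 * (a * 6) by ring, pow_mul, hη, one_pow, one_mul,
      show 42 = 2 * 21 by norm_num, pow_mul, h4, one_pow]
  · intro ha h4
    obtain ⟨q1, q2, q3⟩ := p2 ha
    have h1 : S 0 = cis (ang N a) + cis (-ang N a) := by
      rw [hS]; simp [term, ha, q1, q2, q3]
    rw [h1, cis_add_neg] at h4
    rw [show 42 = 6 * 7 by norm_num, pow_mul, cis_pow_six (by exact_mod_cast h4), one_pow]

theorem dvd_sixty {N : ℕ} (h8 : ¬ 8 ∣ N) (hsq : ∀ p, p.Prime → p ≠ 2 → ¬ p ^ 2 ∣ N)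
    (hbig : ∀ p, p.Prime → 7 ≤ p → ¬ p ∣ N) : N ∣ 60 := by
  rw [Nat.dvd_iff_prime_pow_dvd_dvd]
  intro p k hp hk
  rcases Nat.eq_zero_or_pos k with rfl | hk0
  · simp
  have hpN : p ∣ N := (dvd_pow_self p hk0.ne').trans hk
  have hp7 : p < 7 := by
    by_contra h
    exact hbig p hp (by omega) hpN
  by_cases h2 : p = 2
  · subst h2
    have : k < 3 := by
      by_contra h
      exact h8 ((pow_dvd_pow 2 (by omega : 3 ≤ k)).trans hk)
    interval_cases k <;> norm_num
  · have : k < 2 := by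
      by_contra h
      exact hsq p hp h2 ((pow_dvd_pow p (by omega : 2 ≤ k)).trans hk)
    have : k = 1 := by omega
    subst this
    interval_cases p
    all_goals first | (exfalso; revert hp; norm_num; done) | norm_num

set_option maxHeartbeats 1000000 in
/-- Classification of vanishing sums of four cosines of rational angles. -/
theorem four_cos (N : ℕ) : 0 < N → ∀ n : Fin 4 → ℕ,
    cos (ang N (n 0)) + cos (ang N (n 1)) + cos (ang N (n 2)) + cos (ang N (n 3)) = 0 →
    Degen (ang N (n 0)) (ang N (n 1)) (ang N (n 2)) (ang N (n 3)) ∨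
    (∀ i, N ∣ 60 * n i) ∨ (∀ i, N ∣ 42 * n i) := by
  induction N using Nat.strong_induction_on with
  | _ N ih =>
  intro hN n hs
  by_cases hmin : ∃ p, p.Prime ∧ p ∣ N ∧ ∀ i, p ∣ n i
  · obtain ⟨p, hp, ⟨N', rfl⟩, hdiv⟩ := hmin
    choose n' hn' using hdiv
    have hN' : 0 < N' := Nat.pos_of_mul_pos_left hN
    have hang : ∀ i, ang (p * N') (n i) = ang N' (n' i) := by
      intro i
      have hp0 : (p : ℝ) ≠ 0 := by exact_mod_cast hp.ne_zero
      have hN0 : (N' : ℝ) ≠ 0 := by exact_mod_cast hN'.ne'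
      rw [hn' i, ang, ang]
      push_cast
      field_simp
    have hlt : N' < p * N' := by nlinarith [hp.two_le]
    simp only [hang] at hs ⊢
    have conv : ∀ i m, N' ∣ m * n' i → p * N' ∣ m * n i := by
      intro i m h
      rw [hn' i, show m * (p * n' i) = p * (m * n' i) by ring]
      exact Nat.mul_dvd_mul_left p h
    rcases ih N' hlt hN' n' hs with h | h | h
    · exact Or.inl h
    · exact Or.inr (Or.inl fun i => conv i _ (h i))
    · exact Or.inr (Or.inr fun i => conv i _ (h i))
  push Not at hmin
  have hsum := sum_expo hN n hs
  have hprim := zeta_prim hN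
  by_cases h8 : 8 ∣ N
  · left
    obtain ⟨i, hi⟩ := hmin 2 Nat.prime_two (dvd_trans (by norm_num) h8)
    obtain ⟨m, hm⟩ := h8
    have hNm : N = 4 * (2 * m) := by omega
    have hk : (n i : ZMod 4) ≠ -(n i : ZMod 4) := by
      intro h
      have h3 : ((2 * n i : ℕ) : ZMod 4) = 0 := by push_cast; linear_combination h
      rw [ZMod.natCast_eq_zero_iff] at h3
      omega
    refine split_step hN ⟨2 * m, hNm⟩ n hs i hk ?_
    refine classSum_zero (d := 4) (M := 2 * m) (by norm_num) (by omega) (hNm ▸ hprim) _ hsum ?_ _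
    intro p hp hp4
    have : p ∣ 2 := hp.dvd_of_dvd_pow (show p ∣ 2 ^ 2 by simpa using hp4)
    exact this.mul_right m
  by_cases hsq : ∃ p, p.Prime ∧ p ≠ 2 ∧ p ^ 2 ∣ N
  · left
    obtain ⟨p, hp, hp2, m, hm⟩ := hsq
    have hNm : N = p * (p * m) := by rw [hm]; ring
    obtain ⟨i, hi⟩ := hmin p hp ⟨_, hNm⟩
    refine split_step hN ⟨_, hNm⟩ n hs i (ne_neg_of_odd_prime hp hp2 hi) ?_
    refine classSum_zero (d := p) (M := p * m) hp.pos ?_ (hNm ▸ hprim) _ hsum ?_ _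
    · rcases Nat.eq_zero_or_pos (p * m) with h | h
      · rw [h] at hNm; omega
      · exact h
    · intro q _ hq
      exact hq.mul_right m
  push Not at hsq
  by_cases hbig : ∃ p, p.Prime ∧ 7 ≤ p ∧ p ∣ N
  · obtain ⟨p, hp, hp7, M, hM⟩ := hbig
    have hM0 : 0 < M := by
      rcases Nat.eq_zero_or_pos M with h | h
      · rw [h] at hM; omega
      · exact h
    have hpM : ¬ p ∣ M := by
      rintro ⟨m, rfl⟩
      exact hsq p hp (by omega) ⟨m, by rw [hM]; ring⟩
    have hpN : p ∣ N := ⟨M, hM⟩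
    obtain ⟨η, hη, hconst⟩ := classSum_const hp hM0 (hM ▸ hprim) (expo N n) hsum hpM
    have : NeZero p := ⟨hp.ne_zero⟩
    by_cases hall : ∀ k : ZMod p, ((n 0 : ZMod p) = k ∨ -(n 0 : ZMod p) = k) ∨
        ((n 1 : ZMod p) = k ∨ -(n 1 : ZMod p) = k) ∨ ((n 2 : ZMod p) = k ∨ -(n 2 : ZMod p) = k) ∨
        ((n 3 : ZMod p) = k ∨ -(n 3 : ZMod p) = k)
    · right; right
      have hp8 : p ≤ 8 := by
        have hsub : (Finset.univ : Finset (ZMod p)) ⊆ ([(n 0 : ZMod p), -(n 0 : ZMod p),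
            (n 1 : ZMod p), -(n 1 : ZMod p), (n 2 : ZMod p), -(n 2 : ZMod p),
            (n 3 : ZMod p), -(n 3 : ZMod p)]).toFinset := by
          intro k _
          simp only [List.mem_toFinset, List.mem_cons, List.not_mem_nil, or_false]
          rcases hall k with (h | h) | (h | h) | (h | h) | (h | h) <;> simp [h]
        have := (Finset.card_le_card hsub).trans (List.toFinset_card_le _)
        rwa [Finset.card_univ, ZMod.card] at this
      have hp7' : p = 7 := by
        interval_cases p
        · rfl
        · revert hp; norm_num
      subst hp7'
      have S := classSum_expo hN hpN n
      have c0 := seven_case (n 0) (n 1) (n 2) (n 3) hη _ S hconst hall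
      have c1 := seven_case (n 1) (n 0) (n 2) (n 3) hη _ (fun k => by rw [S k]; ring) hconst
        (fun k => or_left_comm.mp (hall k))
      have c2 := seven_case (n 2) (n 0) (n 1) (n 3) hη _ (fun k => by rw [S k]; ring) hconst
        (fun k => by
          rcases hall k with h | h | h | h
          exacts [Or.inr (Or.inl h), Or.inr (Or.inr (Or.inl h)), Or.inl h,
            Or.inr (Or.inr (Or.inr h))])
      have c3 := seven_case (n 3) (n 0) (n 1) (n 2) hη _ (fun k => by rw [S k]; ring) hconst
        (fun k => by
          rcases hall k with h | h | h | h
          exacts [Or.inr (Or.inl h), Or.inr (Or.inr (Or.inl h)), Or.inr (Or.inr (Or.inr h)),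
            Or.inl h])
      have hS0 : classSum 7 (zeta N) (expo N n) 0 ^ 2 = 1 := by
        by_cases h : (n 0 : ZMod 7) = 0
        · exact (c1.2.1 (c0.2.2.2 h)).1
        · exact (c0.2.1 h).1
      intro i
      apply dvd_of_cis hN
      fin_cases i
      · by_cases h : (n 0 : ZMod 7) = 0
        · exact c0.2.2.1 h hS0
        · exact (c0.2.1 h).2
      · by_cases h : (n 1 : ZMod 7) = 0
        · exact c1.2.2.1 h hS0
        · exact (c1.2.1 h).2
      · by_cases h : (n 2 : ZMod 7) = 0
        · exact c2.2.2.1 h hS0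
        · exact (c2.2.1 h).2
      · by_cases h : (n 3 : ZMod 7) = 0
        · exact c3.2.2.1 h hS0
        · exact (c3.2.1 h).2
    · left
      push Not at hall
      obtain ⟨k, ⟨a1, a2⟩, ⟨b1, b2⟩, ⟨c1, c2⟩, d1, d2⟩ := hall
      have hk0 : classSum p (zeta N) (expo N n) k = 0 := by
        rw [classSum_expo hN hpN]
        simp [term, a1, a2, b1, b2, c1, c2, d1, d2]
      have h0 : classSum p (zeta N) (expo N n) 0 = 0 := by
        have h1 := hconst k.val
        rw [ZMod.natCast_zmod_val, hk0] at h1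
        have hη0 : η ≠ 0 := by
          rintro rfl
          rw [zero_pow hp.ne_zero] at hη
          exact zero_ne_one hη
        exact (mul_eq_zero.mp h1.symm).resolve_left (pow_ne_zero _ hη0)
      obtain ⟨i, hi⟩ := hmin p hp hpN
      refine split_step hN hpN n hs i (ne_neg_of_odd_prime hp (by omega) hi) ?_
      rw [hconst, h0, mul_zero]
  · right; left
    push Not at hbig
    intro i
    exact (dvd_sixty h8 hsq hbig).mul_right _

/-- Bounded universal quantifier, evaluated by the kernel. -/
def allLt : ℕ → (ℕ → Bool) → Bool
  | 0, _ => true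
  | n + 1, f => f n && allLt n f

theorem allLt_spec (n : ℕ) (f : ℕ → Bool) (h : allLt n f = true) : ∀ k < n, f k = true := by
  induction n with
  | zero => intro k hk; omega
  | succ n ih =>
    simp only [allLt, Bool.and_eq_true] at h
    intro k hk
    rcases Nat.lt_succ_iff_lt_or_eq.mp hk with h' | h'
    · exact ih h.2 k h'
    · rw [h']; exact h.1

/-- `g^k + g^(-k)` modulo `q`, where `g` has order `N` modulo `q`. -/
def cosMod (q N g k : ℕ) : ℕ := (g ^ k + g ^ (N - k)) % q

/-- Twice-product-of-sines equation modulo `q`. -/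
def eqMod (q N g a b c d : ℕ) : Bool :=
  Nat.beq ((cosMod q N g (b - a) + cosMod q N g (c + d)) % q)
    ((cosMod q N g (d - c) + cosMod q N g (a + b)) % q)

/-- The solutions, in units of `1/n`, for `a ≤ b`, `c ≤ d`, `a ≤ c`; `h = n/2`, `s = n/6`. -/
def solOK (h s : ℕ) (L : List (ℕ × ℕ × ℕ × ℕ)) (a b c d : ℕ) : Bool :=
  (Nat.beq a 0 && Nat.beq c 0) || (Nat.beq a c && Nat.beq b d) ||
  (Nat.beq (a + b) h && ((Nat.beq c s && Nat.beq d (2 * a)) || (Nat.beq d s && Nat.beq c (2 * a))))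
   || (Nat.beq (c + d) h && ((Nat.beq a s && Nat.beq b (2 * c)) || (Nat.beq b s && Nat.beq a (2 * c))))
   || L.any (fun y => Nat.beq a y.1 && Nat.beq b y.2.1 && Nat.beq c y.2.2.1 && Nat.beq d y.2.2.2)

def chk (q N g h s : ℕ) (L : List (ℕ × ℕ × ℕ × ℕ)) : Bool :=
  allLt (h+1) fun d => allLt (d+1) fun c => allLt (c+1) fun a => allLt (h+1) fun b =>
    (Nat.ble (b+1) a) || !(eqMod q N g a b c d) || solOK h s L a b c d

def L60 : List (ℕ × ℕ × ℕ × ℕ) :=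
  [(2,18,4,8),(3,27,4,16),(2,22,6,6),(4,16,6,10),(4,28,6,14),(5,25,6,18),(6,26,8,16),
   (8,28,9,21),(6,18,10,10),(8,28,10,18),(14,26,18,18),(16,28,18,22)]
def L42 : List (ℕ × ℕ × ℕ × ℕ) :=
  [(2,16,3,9), (3,15,4,10), (8,20,9,15)]

set_option maxRecDepth 10000 in
theorem chk42 : chk 4789 (2 * 42) 150 21 7 L42 = true := by decide +kernel

set_option maxRecDepth 10000 in
theorem chk60 : chk 13681 (2 * 60) 213 30 10 L60 = true := by decide +kernel

theorem chk_spec {q N g h s : ℕ} {L : List (ℕ × ℕ × ℕ × ℕ)} (hc : chk q N g h s L = true)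
    {a b c d : ℕ} (hab : a ≤ b) (hb : b ≤ h) (hcd : c ≤ d) (hd : d ≤ h) (hac : a ≤ c)
    (he : eqMod q N g a b c d = true) :
    (a = 0 ∧ c = 0) ∨ (a = c ∧ b = d) ∨
    (a + b = h ∧ ((c = s ∧ d = 2 * a) ∨ (d = s ∧ c = 2 * a))) ∨
    (c + d = h ∧ ((a = s ∧ b = 2 * c) ∨ (b = s ∧ a = 2 * c))) ∨ (a, b, c, d) ∈ L := by
  unfold chk at hc
  have h1 := allLt_spec _ _ hc d (by omega)
  have h2 := allLt_spec _ _ h1 c (by omega)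
  have h3 := allLt_spec _ _ h2 a (by omega)
  have h4 := allLt_spec _ _ h3 b (by omega)
  simp only [he, Bool.or_eq_true, Bool.not_true, Bool.false_eq_true, or_false] at h4
  rcases h4 with h4 | h4
  · have := Nat.le_of_ble_eq_true h4
    omega
  · simp only [solOK, Bool.or_eq_true, Bool.and_eq_true, List.any_eq_true, Nat.beq_eq] at h4
    rcases h4 with (((h4 | h4) | h4) | h4) | ⟨y, hy, ⟨⟨rfl, rfl⟩, rfl⟩, rfl⟩
    · exact Or.inl h4
    · exact Or.inr (Or.inl h4)
    · exact Or.inr (Or.inr (Or.inl h4))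
    · exact Or.inr (Or.inr (Or.inr (Or.inl h4)))
    · exact Or.inr (Or.inr (Or.inr (Or.inr hy)))

theorem eqMod_of_cos {q N g : ℕ} (hq : q.Prime) (hN : 0 < N)
    (hg : IsPrimitiveRoot (g : ZMod q) N) {a b c d : ℕ}
    (hab : a + b ≤ N) (hcd : c + d ≤ N)
    (h : cos (ang N (b - a)) + cos (ang N (c + d)) = cos (ang N (d - c)) + cos (ang N (a + b))) :
    eqMod q N g a b c d = true := by
  have : Fact q.Prime := ⟨hq⟩
  have hz : ∀ k ≤ N, zeta N ^ k + zeta N ^ (N - k) = ((2 * cos (ang N k) : ℝ) : ℂ) := by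
    intro k hk
    rw [← cis_add_neg, ← zeta_pow]
    congr 1
    apply mul_left_cancel₀ (cis_ne (ang N k))
    rw [cis_mul_neg, ← zeta_pow, ← pow_add, Nat.add_sub_cancel' hk, (zeta_prim hN).pow_eq_one]
  obtain ⟨C, hCd⟩ : ∃ C : ℕ → Polynomial ℤ,
      ∀ k, C k = Polynomial.X ^ k + Polynomial.X ^ (N - k) := ⟨_, fun _ => rfl⟩
  have hC : ∀ k ≤ N, Polynomial.aeval (zeta N) (C k) = ((2 * cos (ang N k) : ℝ) : ℂ) := by
    intro k hk
    rw [← hz k hk]; simp [hCd]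
  have h0 : Polynomial.aeval (zeta N) (C (b - a) + C (c + d) - (C (d - c) + C (a + b))) = 0 := by
    rw [map_sub, map_add, map_add, hC _ (by omega), hC _ (by omega), hC _ (by omega),
      hC _ (by omega)]
    rw [← Complex.ofReal_add, ← Complex.ofReal_add, ← Complex.ofReal_sub]
    norm_cast
    linarith
  obtain ⟨Q, hQ⟩ := cyc_dvd hN (zeta_prim hN) _ h0
  have h1 := congrArg (Polynomial.aeval (g : ZMod q)) hQ
  have hq0 : (q : ZMod q) = 0 := ZMod.natCast_self q
  have h2 : Polynomial.aeval (g : ZMod q) (Polynomial.cyclotomic N ℤ) = 0 := by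
    have := hg.isRoot_cyclotomic hN
    rw [Polynomial.aeval_def, Polynomial.eval₂_eq_eval_map, Polynomial.map_cyclotomic]
    exact this
  rw [map_mul, h2, zero_mul, map_sub, sub_eq_zero] at h1
  unfold eqMod
  rw [Nat.beq_eq, ← Nat.ModEq, ← ZMod.natCast_eq_natCast_iff]
  simp only [cosMod]
  push_cast [ZMod.natCast_mod]
  simpa [hCd] using h1

/-- The conclusion of the main theorem. -/
def Goal (x₁ x₂ x₃ x₄ : ℚ) : Prop :=
    (x₁ * x₂ = 0 ∧ x₃ * x₄ = 0) ∨
    pairEq x₁ x₂ x₃ x₄ ∨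
    (∃ θ : ℝ, 0 < θ ∧ θ ≤ 1/2 ∧
      (((((x₁ : ℝ) = 1/6 ∧ (x₂ : ℝ) = θ) ∨ ((x₁ : ℝ) = θ ∧ (x₂ : ℝ) = 1/6)) ∧
        (((x₃ : ℝ) = θ/2 ∧ (x₄ : ℝ) = 1/2 - θ/2) ∨
         ((x₃ : ℝ) = 1/2 - θ/2 ∧ (x₄ : ℝ) = θ/2))) ∨
       ((((x₃ : ℝ) = 1/6 ∧ (x₄ : ℝ) = θ) ∨ ((x₃ : ℝ) = θ ∧ (x₄ : ℝ) = 1/6)) ∧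
        (((x₁ : ℝ) = θ/2 ∧ (x₂ : ℝ) = 1/2 - θ/2) ∨
         ((x₁ : ℝ) = 1/2 - θ/2 ∧ (x₂ : ℝ) = θ/2))))) ∨
    (∃ y ∈ sporadicList,
      (pairEq x₁ x₂ y.1 y.2.1 ∧ pairEq x₃ x₄ y.2.2.1 y.2.2.2) ∨
      (pairEq x₁ x₂ y.2.2.1 y.2.2.2 ∧ pairEq x₃ x₄ y.1 y.2.1))

theorem pairEq_swap {a b c d : ℚ} (h : pairEq a b c d) : pairEq b a c d := by
  unfold pairEq at *; tauto

theorem goal_swap {a b c d : ℚ} (h : Goal a b c d) : Goal b a c d := by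
  rcases h with h | h | ⟨θ, h0, h1, h⟩ | ⟨y, hy, h⟩
  · left; rw [mul_comm]; exact h
  · right; left; exact pairEq_swap h
  · right; right; left
    refine ⟨θ, h0, h1, ?_⟩
    rcases h with ⟨h, h'⟩ | ⟨h, h'⟩
    · exact Or.inl ⟨h.symm.imp And.symm And.symm, h'⟩
    · exact Or.inr ⟨h, h'.symm.imp And.symm And.symm⟩
  · right; right; right
    exact ⟨y, hy, h.imp (fun h => ⟨pairEq_swap h.1, h.2⟩) (fun h => ⟨pairEq_swap h.1, h.2⟩)⟩

theorem goal_symm {a b c d : ℚ} (h : Goal a b c d) : Goal c d a b := by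
  rcases h with h | h | ⟨θ, h0, h1, h⟩ | ⟨y, hy, h⟩
  · left; exact h.symm
  · right; left; unfold pairEq at *; rcases h with ⟨rfl, rfl⟩ | ⟨rfl, rfl⟩ <;> simp
  · right; right; left
    exact ⟨θ, h0, h1, h.symm⟩
  · right; right; right
    exact ⟨y, hy, h.symm.imp And.symm And.symm⟩

theorem goal_of_sixth {a b c d : ℚ} (hac : a ≤ 1/2) (ha0 : 0 ≤ a) (hs : c + d = 1/2)
    (hb : b = 1/6) (h : a = 2 * c) : Goal a b c d := by
  rcases eq_or_lt_of_le ha0 with h0 | h0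
  · left; subst h0; constructor
    · simp
    · have : c = 0 := by linarith
      simp [this]
  · right; right; left
    refine ⟨a, by exact_mod_cast h0, ?_, Or.inl ⟨Or.inr ⟨rfl, ?_⟩, Or.inl ⟨?_, ?_⟩⟩⟩
    · have : ((a : ℚ) : ℝ) ≤ ((1/2 : ℚ) : ℝ) := by exact_mod_cast hac
      simpa using this
    · rw [hb]; norm_num
    · rw [h]; push_cast; ring
    · have : d = 1/2 - a / 2 := by linarith
      rw [this]; push_cast; ring

theorem goal_of_chk {n h s : ℕ} {L : List (ℕ × ℕ × ℕ × ℕ)} {q g : ℕ} (hn : 0 < n) (hnh : n = 2 * h)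
    (hns : n = 6 * s) (hq : q.Prime) (hg : IsPrimitiveRoot (g : ZMod q) (2 * n))
    (hc : chk q (2 * n) g h s L = true)
    (hL : ∀ a b c d, (a, b, c, d) ∈ L → Goal (a / n) (b / n) (c / n) (d / n))
    {a b c d : ℕ} (hab : a ≤ b) (hb : b ≤ h) (hcd : c ≤ d) (hd : d ≤ h) (hac : a ≤ c)
    (he : cos (ang (2 * n) (b - a)) + cos (ang (2 * n) (c + d))
      = cos (ang (2 * n) (d - c)) + cos (ang (2 * n) (a + b))) :
    Goal (a / n) (b / n) (c / n) (d / n) := by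
  have hn0 : (0 : ℚ) < n := by exact_mod_cast hn
  have hnh' : (n : ℚ) = 2 * h := by exact_mod_cast hnh
  have hns' : (n : ℚ) = 6 * s := by exact_mod_cast hns
  have half : ∀ {x : ℕ}, x ≤ h → (x / n : ℚ) ≤ 1 / 2 := by
    intro x hx
    have : (x : ℚ) ≤ h := by exact_mod_cast hx
    rw [div_le_iff₀ hn0]; linarith
  have sum : ∀ {x y : ℕ}, x + y = h → (x / n : ℚ) + y / n = 1 / 2 := by
    intro x y hx
    have : (x : ℚ) + y = h := by exact_mod_cast hx
    rw [← add_div, this, div_eq_iff hn0.ne']; linarith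
  have six : (s / n : ℚ) = 1 / 6 := by
    rw [div_eq_iff hn0.ne']; linarith
  have dbl : ∀ x : ℕ, ((2 * x : ℕ) / n : ℚ) = 2 * (x / n) := by
    intro x; push_cast; ring
  have pos : ∀ x : ℕ, (0 : ℚ) ≤ x / n := fun x => by positivity
  rcases chk_spec hc hab hb hcd hd hac
    (eqMod_of_cos hq (by omega) hg (by omega) (by omega) he) with
    ⟨rfl, rfl⟩ | ⟨rfl, rfl⟩ | ⟨h1, ⟨rfl, rfl⟩ | ⟨rfl, rfl⟩⟩ | ⟨h1, ⟨rfl, rfl⟩ | ⟨rfl, rfl⟩⟩ | hm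
  · left; simp
  · right; left; left; exact ⟨rfl, rfl⟩
  · exact goal_symm (goal_swap (goal_of_sixth (half hd) (pos _) (sum h1) six (dbl _)))
  · exact goal_symm (goal_of_sixth (half (by omega)) (pos _) (sum h1) six (dbl _))
  · exact goal_swap (goal_of_sixth (half hb) (pos _) (sum h1) six (dbl _))
  · exact goal_of_sixth (half (by omega)) (pos _) (sum h1) six (dbl _)
  · exact hL _ _ _ _ hm

theorem prim60 : IsPrimitiveRoot ((213 : ℕ) : ZMod 13681) (2 * 60) := by
  have h1 : ((213 : ℕ) : ZMod 13681) ^ (2 * 60) = 1 := by decide +kernel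
  have h2 : ∀ l < 2 * 60, 0 < l → ((213 : ℕ) : ZMod 13681) ^ l ≠ 1 := by decide +kernel
  exact IsPrimitiveRoot.mk_of_lt _ (by norm_num) h1 fun l h0 hl => h2 l hl h0

set_option maxHeartbeats 4000000 in
theorem goal60 {a b c d : ℕ} (hab : a ≤ b) (hb : b ≤ 30) (hcd : c ≤ d) (hd : d ≤ 30) (hac : a ≤ c)
    (he : cos (ang (2 * 60) (b - a)) + cos (ang (2 * 60) (c + d))
      = cos (ang (2 * 60) (d - c)) + cos (ang (2 * 60) (a + b))) :
    Goal (a / (60 : ℕ)) (b / (60 : ℕ)) (c / (60 : ℕ)) (d / (60 : ℕ)) := by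
  refine goal_of_chk (n := 60) (h := 30) (s := 10) (L := L60) (q := 13681) (g := 213)
    (by norm_num) (by norm_num) (by norm_num) (by norm_num) prim60 chk60 ?_ hab hb hcd hd hac he
  · intro a b c d hm
    right; right; right
    simp only [L60, List.mem_cons, Prod.mk.injEq, List.not_mem_nil, or_false] at hm
    rcases hm with ⟨rfl, rfl, rfl, rfl⟩ | ⟨rfl, rfl, rfl, rfl⟩ | ⟨rfl, rfl, rfl, rfl⟩ |
      ⟨rfl, rfl, rfl, rfl⟩ | ⟨rfl, rfl, rfl, rfl⟩ | ⟨rfl, rfl, rfl, rfl⟩ | ⟨rfl, rfl, rfl, rfl⟩ |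
      ⟨rfl, rfl, rfl, rfl⟩ | ⟨rfl, rfl, rfl, rfl⟩ | ⟨rfl, rfl, rfl, rfl⟩ | ⟨rfl, rfl, rfl, rfl⟩ |
      ⟨rfl, rfl, rfl, rfl⟩ <;> norm_num [sporadicList, pairEq]

theorem prim42 : IsPrimitiveRoot ((150 : ℕ) : ZMod 4789) (2 * 42) := by
  have h1 : ((150 : ℕ) : ZMod 4789) ^ (2 * 42) = 1 := by decide +kernel
  have h2 : ∀ l < 2 * 42, 0 < l → ((150 : ℕ) : ZMod 4789) ^ l ≠ 1 := by decide +kernel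
  exact IsPrimitiveRoot.mk_of_lt _ (by norm_num) h1 fun l h0 hl => h2 l hl h0

theorem goal42 {a b c d : ℕ} (hab : a ≤ b) (hb : b ≤ 21) (hcd : c ≤ d) (hd : d ≤ 21) (hac : a ≤ c)
    (he : cos (ang (2 * 42) (b - a)) + cos (ang (2 * 42) (c + d))
      = cos (ang (2 * 42) (d - c)) + cos (ang (2 * 42) (a + b))) :
    Goal (a / (42 : ℕ)) (b / (42 : ℕ)) (c / (42 : ℕ)) (d / (42 : ℕ)) := by
  refine goal_of_chk (n := 42) (h := 21) (s := 7) (L := L42) (q := 4789) (g := 150)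
    (by norm_num) (by norm_num) (by norm_num) (by norm_num) prim42 chk42 ?_ hab hb hcd hd hac he
  · intro a b c d hm
    right; right; right
    simp only [L42, List.mem_cons, Prod.mk.injEq, List.not_mem_nil, or_false] at hm
    rcases hm with ⟨rfl, rfl, rfl, rfl⟩ | ⟨rfl, rfl, rfl, rfl⟩ | ⟨rfl, rfl, rfl, rfl⟩ <;>
      norm_num [sporadicList, pairEq]

theorem cosq {r s : ℚ} (hr0 : 0 ≤ r) (hr1 : r ≤ 1) (hs0 : 0 ≤ s) (hs1 : s ≤ 1)
    (h : cos ((r : ℝ) * π) = cos ((s : ℝ) * π)) : r = s := by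
  have e : ∀ {t : ℚ}, 0 ≤ t → t ≤ 1 → (t : ℝ) * π ∈ Set.Icc 0 π := by
    intro t h0 h1
    have h0' : (0 : ℝ) ≤ t := by exact_mod_cast h0
    have h1' : (t : ℝ) ≤ 1 := by exact_mod_cast h1
    constructor
    · exact mul_nonneg h0' pi_pos.le
    · nlinarith [pi_pos]
  have := injOn_cos (e hr0 hr1) (e hs0 hs1) h
  have := mul_right_cancel₀ pi_ne_zero this
  exact_mod_cast this

theorem sin_zero_q {r : ℚ} (h0 : 0 ≤ r) (h1 : r ≤ 1/2) (h : sin ((r : ℝ) * π) = 0) : r = 0 := by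
  have h2 : cos ((1/2 - r : ℚ) * π) = cos ((1/2 : ℚ) * π) := by
    push_cast
    rw [sub_mul, show (1/2 : ℝ) * π = π / 2 by ring, cos_pi_div_two_sub, h, cos_pi_div_two]
  have := cosq (by linarith) (by linarith) (by norm_num) (by norm_num) h2
  linarith

theorem prod_zero {r s : ℚ} (hr0 : 0 ≤ r) (hr1 : r ≤ 1/2) (hs0 : 0 ≤ s) (hs1 : s ≤ 1/2)
    (h : sin ((r : ℝ) * π) * sin ((s : ℝ) * π) = 0) : r * s = 0 := by
  rcases mul_eq_zero.mp h with h | h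
  · rw [sin_zero_q hr0 hr1 h, zero_mul]
  · rw [sin_zero_q hs0 hs1 h, mul_zero]

/-- The one-parameter family. -/
theorem goal_family {a b c d : ℚ} (ha0 : 0 ≤ a) (ha1 : a ≤ 1/2)
    (hb0 : 0 ≤ b) (hc0 : 0 ≤ c) (hcd : c ≤ d) (hd1 : d ≤ 1/2)
    (hz : cos (((c + d : ℚ) : ℝ) * π) = 0) (hb : cos (2 * ((b : ℝ) * π)) = 1/2) (hb1 : b ≤ 1/2)
    (h : sin ((a : ℝ) * π) * sin ((b : ℝ) * π) = sin ((c : ℝ) * π) * sin ((d : ℝ) * π)) :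
    Goal a b c d := by
  have hs : c + d = 1/2 := by
    refine cosq (by linarith) (by linarith) (by norm_num) (by norm_num) ?_
    rw [hz]; push_cast
    rw [show (1/2 : ℝ) * π = π / 2 by ring, cos_pi_div_two]
  have hb6 : b = 1/6 := by
    have : cos (((2 * b : ℚ) : ℝ) * π) = cos (((1/3 : ℚ) : ℝ) * π) := by
      push_cast
      rw [mul_assoc, hb, show (1/3 : ℝ) * π = π / 3 by ring, cos_pi_div_three]
    have := cosq (by linarith) (by linarith) (by norm_num) (by norm_num) this
    linarith
  refine goal_of_sixth ha1 ha0 hs hb6 ?_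
  have h1 : sin ((b : ℝ) * π) = 1/2 := by
    rw [hb6]; push_cast
    rw [show (1/6 : ℝ) * π = π / 6 by ring, sin_pi_div_six]
  have h2 : sin ((d : ℝ) * π) = cos ((c : ℝ) * π) := by
    have : d = 1/2 - c := by linarith
    rw [this]; push_cast
    rw [sub_mul, show (1/2 : ℝ) * π = π / 2 by ring, sin_pi_div_two_sub]
  rw [h1, h2] at h
  have h3 : sin ((a : ℝ) * π) = sin (2 * ((c : ℝ) * π)) := by
    rw [sin_two_mul]; linarith
  have h4 : cos (((1/2 - a : ℚ) : ℝ) * π) = cos (((1/2 - 2 * c : ℚ) : ℝ) * π) := by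
    push_cast
    rw [sub_mul, sub_mul, show (1/2 : ℝ) * π = π / 2 by ring, cos_pi_div_two_sub,
      cos_pi_div_two_sub, h3, mul_assoc]
  have := cosq (by linarith) (by linarith) (by linarith) (by linarith) h4
  linarith

theorem goal_degen {a b c d : ℚ} (ha0 : 0 ≤ a) (hab : a ≤ b) (hb1 : b ≤ 1/2)
    (hc0 : 0 ≤ c) (hcd : c ≤ d) (hd1 : d ≤ 1/2)
    (h : sin ((a : ℝ) * π) * sin ((b : ℝ) * π) = sin ((c : ℝ) * π) * sin ((d : ℝ) * π))
    (hD : Degen (b * π - a * π) (a * π + b * π + π) (d * π - c * π + π) (c * π + d * π)) :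
    Goal a b c d := by
  have z : ∀ {r s : ℚ}, 0 ≤ r → r ≤ s → s ≤ 1/2 → cos ((s : ℝ) * π - r * π) = 0 → r = 0 := by
    intro r s h0 h1 h2 h3
    have : cos (((s - r : ℚ) : ℝ) * π) = cos (((1/2 : ℚ) : ℝ) * π) := by
      push_cast
      rw [sub_mul, h3, show (1/2 : ℝ) * π = π / 2 by ring, cos_pi_div_two]
    have := cosq (by linarith) (by linarith) (by norm_num) (by norm_num) this
    linarith
  have ha1 : a ≤ 1/2 := by linarith
  have hb0 : 0 ≤ b := by linarith
  have hc1 : c ≤ 1/2 := by linarith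
  have hd0 : 0 ≤ d := by linarith
  have nearL : Near (b * π - a * π) (a * π + b * π + π) →
      cos (2 * ((a : ℝ) * π)) = 1/2 ∨ cos (2 * ((b : ℝ) * π)) = 1/2 := by
    rintro (h | h)
    · left
      rw [show (b : ℝ) * π - a * π - (a * π + b * π + π) = -(2 * (a * π) + π) by ring, cos_neg,
        cos_add_pi] at h
      linarith
    · right
      rw [show (b : ℝ) * π - a * π + (a * π + b * π + π) = 2 * (b * π) + π by ring,
        cos_add_pi] at h
      linarith
  have nearR : Near (d * π - c * π + π) (c * π + d * π) →
      cos (2 * ((c : ℝ) * π)) = 1/2 ∨ cos (2 * ((d : ℝ) * π)) = 1/2 := by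
    rintro (h | h)
    · left
      rw [show (d : ℝ) * π - c * π + π - (c * π + d * π) = -(2 * (c * π) - π) by ring, cos_neg,
        cos_sub_pi] at h
      linarith
    · right
      rw [show (d : ℝ) * π - c * π + π + (c * π + d * π) = 2 * (d * π) + π by ring,
        cos_add_pi] at h
      linarith
  have prod0 : sin ((a : ℝ) * π) * sin ((b : ℝ) * π) = 0 → Goal a b c d := fun h0 =>
    Or.inl ⟨prod_zero ha0 ha1 hb0 hb1 h0, prod_zero hc0 hc1 hd0 hd1 (h ▸ h0)⟩
  rcases hD with ⟨e1, _⟩ | ⟨e1, e2⟩ | ⟨e1, e2⟩ | ⟨e1, e2, _⟩ | ⟨e1, _⟩ | ⟨e1, _, _, e2⟩ | ⟨e1, _⟩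
  · apply prod0
    rw [cos_add_pi, cos_sub, cos_add] at e1
    linarith
  · rw [cos_add_pi] at e1 e2
    have k1 := cosq (r := b - a) (s := d - c) (by linarith) (by linarith) (by linarith)
      (by linarith) (by push_cast; rw [sub_mul, sub_mul]; linarith)
    have k2 := cosq (r := a + b) (s := c + d) (by linarith) (by linarith) (by linarith)
      (by linarith) (by push_cast; rw [add_mul, add_mul]; linarith)
    right; left; left
    constructor <;> linarith
  · rw [cos_add_pi, cos_add_pi] at e2
    have k1 := cosq (r := b - a) (s := 1 - (c + d)) (by linarith) (by linarith) (by linarith)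
      (by linarith) (by
        push_cast; rw [sub_mul, sub_mul, one_mul, cos_pi_sub, add_mul]; linarith)
    have k2 := cosq (r := a + b) (s := 1 - (d - c)) (by linarith) (by linarith) (by linarith)
      (by linarith) (by
        push_cast; rw [sub_mul, one_mul, cos_pi_sub, sub_mul, add_mul]; linarith)
    right; left; left
    constructor <;> linarith
  · have e1' : cos (((c + d : ℚ) : ℝ) * π) = 0 := by push_cast; rw [add_mul]; exact e1
    rcases nearL e2 with e | e
    · exact goal_swap (goal_family hb0 hb1 ha0 hc0 hcd hd1 e1' e ha1 (by linarith))
    · exact goal_family ha0 ha1 hb0 hc0 hcd hd1 e1' e hb1 h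
  · apply prod0
    rw [cos_add_pi] at e1
    rw [h, z hc0 hcd hd1 (by linarith)]
    simp
  · have e1' : cos (((a + b : ℚ) : ℝ) * π) = 0 := by
      rw [cos_add_pi] at e1
      push_cast; rw [add_mul]; linarith
    apply goal_symm
    rcases nearR e2 with e | e
    · exact goal_swap (goal_family hd0 hd1 hc0 ha0 hab hb1 e1' e hc1 (by linarith))
    · exact goal_family hc0 hc1 hd0 ha0 hab hb1 e1' e hd1 h.symm
  · apply prod0
    rw [z ha0 hab hb1 e1]
    simp

theorem cos_form {x y z w : ℝ} (h : sin x * sin y = sin z * sin w) :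
    cos (y - x) + cos (z + w) = cos (w - z) + cos (x + y) := by
  rw [cos_sub, cos_sub, cos_add, cos_add]; linarith

/-- From an integrality statement, get a numerator over `n`. -/
theorem numer {n D k : ℕ} (hn : 0 < n) (hD : 0 < D) (h : D ∣ n * k) (hk : 2 * k ≤ D) :
    ∃ m : ℕ, 2 * m ≤ n ∧ (k / D : ℚ) = m / n := by
  obtain ⟨m, hm⟩ := h
  refine ⟨m, ?_, ?_⟩
  · by_contra hc
    push Not at hc
    nlinarith
  · have hD' : (D : ℚ) ≠ 0 := by exact_mod_cast hD.ne'
    have hn' : (n : ℚ) ≠ 0 := by exact_mod_cast hn.ne'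
    have hm' : (n : ℚ) * k = D * m := by exact_mod_cast hm
    field_simp
    linarith

theorem div_both {n D j k : ℕ} {x y : ℕ} (hjk : j ≤ k) (hx : 2 * D ∣ n * (k - j + x * D))
    (hy : 2 * D ∣ n * (j + k + y * D)) (hn : 2 ∣ n * (x + y)) (hD : 0 < D) :
    D ∣ n * j ∧ D ∣ n * k := by
  obtain ⟨t, ht⟩ := hn
  obtain ⟨i, rfl⟩ := Nat.exists_eq_add_of_le hjk
  rw [Nat.add_sub_cancel_left] at hx
  obtain ⟨u, hu⟩ := hx
  obtain ⟨v, hv⟩ := hy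
  have ht' : (n : ℤ) * (x + y) = 2 * t := by exact_mod_cast ht
  have hu' : (n : ℤ) * (i + x * D) = 2 * D * u := by exact_mod_cast hu
  have hv' : (n : ℤ) * (j + (j + i) + y * D) = 2 * D * v := by exact_mod_cast hv
  constructor
  · have : (D : ℤ) ∣ ((n * j : ℕ) : ℤ) := by
      refine ⟨v - u - n * y + t, ?_⟩
      push_cast
      apply mul_left_cancel₀ (two_ne_zero (α := ℤ))
      linear_combination hv' - hu' + (D : ℤ) * ht'
    exact_mod_cast this
  · have : (D : ℤ) ∣ ((n * (j + i) : ℕ) : ℤ) := by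
      refine ⟨v + u - t, ?_⟩
      push_cast
      apply mul_left_cancel₀ (two_ne_zero (α := ℤ))
      linear_combination hv' + hu' - (D : ℤ) * ht'
    exact_mod_cast this

theorem goal_sorted {a b c d : ℚ} (ha0 : 0 ≤ a) (hab : a ≤ b) (hb1 : b ≤ 1/2)
    (hac : a ≤ c) (hcd : c ≤ d) (hd1 : d ≤ 1/2)
    (h : sin ((a : ℝ) * π) * sin ((b : ℝ) * π) = sin ((c : ℝ) * π) * sin ((d : ℝ) * π)) :
    Goal a b c d := by
  obtain ⟨D, hD, A, B, C, E, rfl, rfl, rfl, rfl⟩ : ∃ D : ℕ, 0 < D ∧ ∃ A B C E : ℕ,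
      a = A / D ∧ b = B / D ∧ c = C / D ∧ d = E / D := by
    have e : ∀ r : ℚ, 0 ≤ r → r = (r.num.toNat : ℚ) / r.den := by
      intro r hr
      have h1 : ((r.num.toNat : ℕ) : ℚ) = (r.num : ℚ) := by
        exact_mod_cast Int.toNat_of_nonneg (Rat.num_nonneg.mpr hr)
      rw [h1]; exact (Rat.num_div_den r).symm
    refine ⟨a.den * b.den * c.den * d.den, ?_, a.num.toNat * (b.den * c.den * d.den),
      b.num.toNat * (a.den * c.den * d.den), c.num.toNat * (a.den * b.den * d.den),
      d.num.toNat * (a.den * b.den * c.den), ?_, ?_, ?_, ?_⟩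
    · have := a.den_pos; have := b.den_pos; have := c.den_pos; have := d.den_pos
      positivity
    all_goals
      have h1 : (a.den : ℚ) ≠ 0 := by exact_mod_cast a.den_nz
      have h2 : (b.den : ℚ) ≠ 0 := by exact_mod_cast b.den_nz
      have h3 : (c.den : ℚ) ≠ 0 := by exact_mod_cast c.den_nz
      have h4 : (d.den : ℚ) ≠ 0 := by exact_mod_cast d.den_nz
    · conv_lhs => rw [e a ha0]
      push_cast; field_simp
    · conv_lhs => rw [e b (by linarith)]
      push_cast; field_simp
    · conv_lhs => rw [e c (by linarith)]
      push_cast; field_simp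
    · conv_lhs => rw [e d (by linarith)]
      push_cast; field_simp
  have hDq : (0 : ℚ) < D := by exact_mod_cast hD
  have hDr : (D : ℝ) ≠ 0 := by exact_mod_cast hD.ne'
  have nle : ∀ {x y : ℕ}, (x / D : ℚ) ≤ y / D → x ≤ y := by
    intro x y hxy
    rw [div_le_div_iff_of_pos_right hDq] at hxy
    exact_mod_cast hxy
  have nhalf : ∀ {x : ℕ}, (x / D : ℚ) ≤ 1 / 2 → 2 * x ≤ D := by
    intro x hx
    rw [div_le_iff₀ hDq] at hx
    have : (2 * x : ℚ) ≤ D := by linarith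
    exact_mod_cast this
  have nAB := nle hab
  have nCE := nle hcd
  have nB := nhalf hb1
  have nE := nhalf hd1
  have g1 : ang (2 * D) (B - A) = ((B / D : ℚ) : ℝ) * π - ((A / D : ℚ) : ℝ) * π := by
    unfold ang; push_cast [Nat.cast_sub nAB]; field_simp
  have g2 : ang (2 * D) (A + B + D) = ((A / D : ℚ) : ℝ) * π + ((B / D : ℚ) : ℝ) * π + π := by
    unfold ang; push_cast; field_simp
  have g3 : ang (2 * D) (E - C + D) = ((E / D : ℚ) : ℝ) * π - ((C / D : ℚ) : ℝ) * π + π := by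
    unfold ang; push_cast [Nat.cast_sub nCE]; field_simp
  have g4 : ang (2 * D) (C + E) = ((C / D : ℚ) : ℝ) * π + ((E / D : ℚ) : ℝ) * π := by
    unfold ang; push_cast; field_simp
  have hcf := cos_form h
  have hfin : ∀ n : ℕ, 0 < n → D ∣ n * A → D ∣ n * B → D ∣ n * C → D ∣ n * E →
      ∃ a b c e : ℕ, a ≤ b ∧ 2 * b ≤ n ∧ c ≤ e ∧ 2 * e ≤ n ∧ a ≤ c ∧
      (A / D : ℚ) = a / n ∧ (B / D : ℚ) = b / n ∧ (C / D : ℚ) = c / n ∧ (E / D : ℚ) = e / n ∧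
      cos (ang (2 * n) (b - a)) + cos (ang (2 * n) (c + e))
        = cos (ang (2 * n) (e - c)) + cos (ang (2 * n) (a + b)) := by
    intro n hn dA dB dC dE
    have nAC := nle hac
    obtain ⟨a, ha, ea⟩ := numer hn hD dA (by omega)
    obtain ⟨b, hb, eb⟩ := numer hn hD dB (by omega)
    obtain ⟨c, hc, ec⟩ := numer hn hD dC (by omega)
    obtain ⟨e, he, ee⟩ := numer hn hD dE (by omega)
    have hnq : (0 : ℚ) < n := by exact_mod_cast hn
    have hnr : (n : ℝ) ≠ 0 := by exact_mod_cast hn.ne'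
    rw [ea, eb, ec, ee] at hcf
    rw [ea, eb] at hab
    rw [ec, ee] at hcd
    rw [ea, ec] at hac
    have nle' : ∀ {x y : ℕ}, (x / n : ℚ) ≤ y / n → x ≤ y := by
      intro x y hxy
      rw [div_le_div_iff_of_pos_right hnq] at hxy
      exact_mod_cast hxy
    have nab := nle' hab
    have nce := nle' hcd
    refine ⟨a, b, c, e, nab, hb, nce, he, nle' hac, ea, eb, ec, ee, ?_⟩
    have f1 : ang (2 * n) (b - a) = ((b / n : ℚ) : ℝ) * π - ((a / n : ℚ) : ℝ) * π := by
      unfold ang; push_cast [Nat.cast_sub nab]; field_simp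
    have f2 : ang (2 * n) (a + b) = ((a / n : ℚ) : ℝ) * π + ((b / n : ℚ) : ℝ) * π := by
      unfold ang; push_cast; field_simp
    have f3 : ang (2 * n) (e - c) = ((e / n : ℚ) : ℝ) * π - ((c / n : ℚ) : ℝ) * π := by
      unfold ang; push_cast [Nat.cast_sub nce]; field_simp
    have f4 : ang (2 * n) (c + e) = ((c / n : ℚ) : ℝ) * π + ((e / n : ℚ) : ℝ) * π := by
      unfold ang; push_cast; field_simp
    rw [f1, f2, f3, f4]
    exact hcf
  have hmain := four_cos (2 * D) (by omega) ![B - A, A + B + D, E - C + D, C + E] (by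
    simp only [Matrix.cons_val]
    rw [g1, g2, g3, g4, cos_add_pi, cos_add_pi]
    linarith)
  simp only [Matrix.cons_val, g1, g2, g3, g4] at hmain
  rcases hmain with hm | hm | hm
  · exact goal_degen ha0 hab hb1 (by linarith) hcd hd1 h hm
  · have m0 := hm 0
    have m1 := hm 1
    have m2 := hm 2
    have m3 := hm 3
    simp only [Matrix.cons_val] at m0 m1 m2 m3
    obtain ⟨dA, dB⟩ := div_both (n := 60) (x := 0) (y := 1) nAB (by simpa using m0)
      (by simpa using m1) (by norm_num) hD
    obtain ⟨dC, dE⟩ := div_both (n := 60) (x := 1) (y := 0) nCE (by simpa using m2)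
      (by simpa using m3) (by norm_num) hD
    obtain ⟨a, b, c, e, k1, k2, k3, k4, k5, ea, eb, ec, ee, k⟩ :=
      hfin 60 (by norm_num) dA dB dC dE
    rw [ea, eb, ec, ee]
    exact goal60 k1 (by omega) k3 (by omega) k5 k
  · have m0 := hm 0
    have m1 := hm 1
    have m2 := hm 2
    have m3 := hm 3
    simp only [Matrix.cons_val] at m0 m1 m2 m3
    obtain ⟨dA, dB⟩ := div_both (n := 42) (x := 0) (y := 1) nAB (by simpa using m0)
      (by simpa using m1) (by norm_num) hD
    obtain ⟨dC, dE⟩ := div_both (n := 42) (x := 1) (y := 0) nCE (by simpa using m2)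
      (by simpa using m3) (by norm_num) hD
    obtain ⟨a, b, c, e, k1, k2, k3, k4, k5, ea, eb, ec, ee, k⟩ :=
      hfin 42 (by norm_num) dA dB dC dE
    rw [ea, eb, ec, ee]
    exact goal42 k1 (by omega) k3 (by omega) k5 k

theorem goal_half {a b c d : ℚ} (ha0 : 0 ≤ a) (hab : a ≤ b) (hb1 : b ≤ 1/2)
    (hc0 : 0 ≤ c) (hcd : c ≤ d) (hd1 : d ≤ 1/2)
    (h : sin ((a : ℝ) * π) * sin ((b : ℝ) * π) = sin ((c : ℝ) * π) * sin ((d : ℝ) * π)) :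
    Goal a b c d := by
  rcases le_total a c with hac | hac
  · exact goal_sorted ha0 hab hb1 hac hcd hd1 h
  · exact goal_symm (goal_sorted hc0 hcd hd1 hac hab hb1 h.symm)

theorem goal_all (x₁ x₂ x₃ x₄ : ℚ)
    (h₁ : 0 ≤ x₁ ∧ x₁ ≤ 1/2) (h₂ : 0 ≤ x₂ ∧ x₂ ≤ 1/2)
    (h₃ : 0 ≤ x₃ ∧ x₃ ≤ 1/2) (h₄ : 0 ≤ x₄ ∧ x₄ ≤ 1/2)
    (heq : sin ((x₁ : ℝ) * π) * sin ((x₂ : ℝ) * π) = sin ((x₃ : ℝ) * π) * sin ((x₄ : ℝ) * π)) :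
    Goal x₁ x₂ x₃ x₄ := by
  rcases le_total x₁ x₂ with hab | hab <;> rcases le_total x₃ x₄ with hcd | hcd
  · exact goal_half h₁.1 hab h₂.2 h₃.1 hcd h₄.2 heq
  · exact goal_symm (goal_swap (goal_symm
      (goal_half h₁.1 hab h₂.2 h₄.1 hcd h₃.2 (by linarith))))
  · exact goal_swap (goal_half h₂.1 hab h₁.2 h₃.1 hcd h₄.2 (by linarith))
  · exact goal_swap (goal_symm (goal_swap (goal_symm
      (goal_half h₂.1 hab h₁.2 h₄.1 hcd h₃.2 (by linarith)))))

theorem rational_sine_product_classification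
    (x₁ x₂ x₃ x₄ : ℚ)
    (h₁ : 0 ≤ x₁ ∧ x₁ ≤ 1/2) (h₂ : 0 ≤ x₂ ∧ x₂ ≤ 1/2)
    (h₃ : 0 ≤ x₃ ∧ x₃ ≤ 1/2) (h₄ : 0 ≤ x₄ ∧ x₄ ≤ 1/2)
    (heq : Real.sin ((x₁ : ℝ) * π) * Real.sin ((x₂ : ℝ) * π)
         = Real.sin ((x₃ : ℝ) * π) * Real.sin ((x₄ : ℝ) * π)) :
    (x₁ * x₂ = 0 ∧ x₃ * x₄ = 0) ∨
    pairEq x₁ x₂ x₃ x₄ ∨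
    (∃ θ : ℝ, 0 < θ ∧ θ ≤ 1/2 ∧
      (((((x₁ : ℝ) = 1/6 ∧ (x₂ : ℝ) = θ) ∨ ((x₁ : ℝ) = θ ∧ (x₂ : ℝ) = 1/6)) ∧
        (((x₃ : ℝ) = θ/2 ∧ (x₄ : ℝ) = 1/2 - θ/2) ∨
         ((x₃ : ℝ) = 1/2 - θ/2 ∧ (x₄ : ℝ) = θ/2))) ∨
       ((((x₃ : ℝ) = 1/6 ∧ (x₄ : ℝ) = θ) ∨ ((x₃ : ℝ) = θ ∧ (x₄ : ℝ) = 1/6)) ∧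
        (((x₁ : ℝ) = θ/2 ∧ (x₂ : ℝ) = 1/2 - θ/2) ∨
         ((x₁ : ℝ) = 1/2 - θ/2 ∧ (x₂ : ℝ) = θ/2))))) ∨
    (∃ y ∈ sporadicList,
      (pairEq x₁ x₂ y.1 y.2.1 ∧ pairEq x₃ x₄ y.2.2.1 y.2.2.2) ∨
      (pairEq x₁ x₂ y.2.2.1 y.2.2.2 ∧ pairEq x₃ x₄ y.1 y.2.1)) := by
  exact goal_all x₁ x₂ x₃ x₄ h₁ h₂ h₃ h₄ heq
end

section
/- Let f ≥ 6 be an even integer and set α = 2/f, β = (4f−4)/(3f), γ = 4/f, δ = (2f−2)/(3f). Then nonnegative integers (k,l,m,n) with k + n even satisfy kα + lβ + mγ + nδ = 2 if and only if (k,l,m,n) is of one of the following forms: (1,1,0,1); (1,0,0,3); (k,1,m,0) with k even and 6m = f + 2 − 3k; (k,0,m,2) with k even and 6m = f + 2 − 3k; (k,0,m,1) with k odd and 6m = 2f + 1 − 3k; (k,0,m,0) with k even and 2m = f − k. -/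
theorem avc_second_infinite_sequence (f : ℕ) (hEven : Even f) (hf : 6 ≤ f)
    (k l m n : ℕ) (hpar : Even (k + n)) :
    ((k : ℚ) * (2/(f : ℚ)) + (l : ℚ) * ((4*(f : ℚ) - 4)/(3*(f : ℚ)))
      + (m : ℚ) * (4/(f : ℚ)) + (n : ℚ) * ((2*(f : ℚ) - 2)/(3*(f : ℚ))) = 2)
    ↔ ((k, l, m, n) = (1, 1, 0, 1) ∨
       (k, l, m, n) = (1, 0, 0, 3) ∨
       (l = 1 ∧ n = 0 ∧ Even k ∧ 3 * k + 6 * m = f + 2) ∨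
       (l = 0 ∧ n = 2 ∧ Even k ∧ 3 * k + 6 * m = f + 2) ∨
       (l = 0 ∧ n = 1 ∧ Odd k ∧ 3 * k + 6 * m = 2 * f + 1) ∨
       (l = 0 ∧ n = 0 ∧ Even k ∧ k + 2 * m = f)) := by
  obtain ⟨g, rfl⟩ : ∃ g, f = g + 1 := ⟨f - 1, by omega⟩
  have key : ((k : ℚ) * (2/((g + 1 : ℕ) : ℚ))
      + (l : ℚ) * ((4*((g + 1 : ℕ) : ℚ) - 4)/(3*((g + 1 : ℕ) : ℚ)))
      + (m : ℚ) * (4/((g + 1 : ℕ) : ℚ))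
      + (n : ℚ) * ((2*((g + 1 : ℕ) : ℚ) - 2)/(3*((g + 1 : ℕ) : ℚ))) = 2)
      ↔ 3 * k + 6 * m + (2 * l + n) * g = 3 * (g + 1) := by
    have hg : ((g : ℚ) + 1) ≠ 0 := by positivity
    rw [← @Nat.cast_inj ℚ]
    push_cast
    have e : (k : ℚ) * (2/((g : ℚ) + 1)) + (l : ℚ) * ((4*((g : ℚ) + 1) - 4)/(3*((g : ℚ) + 1)))
      + (m : ℚ) * (4/((g : ℚ) + 1)) + (n : ℚ) * ((2*((g : ℚ) + 1) - 2)/(3*((g : ℚ) + 1)))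
      = (2 * (3 * k + 6 * m + (2 * l + n) * g)) / (3 * ((g : ℚ) + 1)) := by
      field_simp
      ring
    rw [e, div_eq_iff (by positivity)]
    constructor <;> intro h <;> linarith
  rw [key]
  simp only [Prod.mk.injEq, Nat.even_iff, Nat.odd_iff] at *
  constructor
  · intro h
    have hs : 2 * l + n ≤ 3 := by
      by_contra hc
      have : 4 * g ≤ (2 * l + n) * g := Nat.mul_le_mul_right g (by omega)
      omega
    have hl : l ≤ 1 := by omega
    have hn : n ≤ 3 := by omega
    interval_cases l <;> interval_cases n <;> omega
  · rintro (⟨rfl, rfl, rfl, rfl⟩ | ⟨rfl, rfl, rfl, rfl⟩ | ⟨rfl, rfl, h1, h2⟩ | ⟨rfl, rfl, h1, h2⟩ |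
      ⟨rfl, rfl, h1, h2⟩ | ⟨rfl, rfl, h1, h2⟩) <;> omega
end
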